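/- arXiv:1805.07589 — 7 statements merged into one kernel-verified Lean document; each statement's English description precedes it below -/
import Mathlib

section
/- Let B(v₁, r₁), …, B(v_k, r_k) be finitely many closed balls in the Euclidean space ℝ^d with centers v₁, …, v_k and radii r₁, …, r_k. If all the balls have at least one point in common (their intersection is nonempty), then the convex hull of the centers {v₁, …, v_k} is contained in the union of the balls. -/
/-- If finitely many closed balls have a point in common, then the convex hull of
their centers is contained in their union. -/
theorem convexHull_centers_subset_union_closedBalls {d k : ℕ}
    (v : Fin k → EuclideanSpace ℝ (Fin d)) (r : Fin k → ℝ)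
    (h : (⋂ i, Metric.closedBall (v i) (r i)).Nonempty) :
    convexHull ℝ (Set.range v) ⊆ ⋃ i, Metric.closedBall (v i) (r i) := by
  intro x hx
  obtain ⟨p, hp⟩ := h
  by_contra hn
  simp only [Set.mem_iUnion, Set.mem_iInter, Metric.mem_closedBall, not_exists, not_le] at hn hp
  have key : ∀ y : EuclideanSpace ℝ (Fin d), dist p y < dist x y →
      inner ℝ (x - p) y < (‖x‖ ^ 2 - ‖p‖ ^ 2) / 2 := by
    intro y hy
    rw [dist_eq_norm, dist_eq_norm] at hy
    have h2 : ‖p - y‖ ^ 2 < ‖x - y‖ ^ 2 := by gcongr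
    rw [norm_sub_sq_real, norm_sub_sq_real] at h2
    rw [inner_sub_left]
    linarith
  have hc : Convex ℝ {y : EuclideanSpace ℝ (Fin d) |
      inner ℝ (x - p) y < (‖x‖ ^ 2 - ‖p‖ ^ 2) / 2} :=
    convex_halfSpace_lt (f := fun y => inner ℝ (x - p) y)
      ⟨fun a b => inner_add_right _ _ _, fun c a => real_inner_smul_right _ _ _⟩ _
  have hm := convexHull_min (s := Set.range v) (by
    rintro _ ⟨i, rfl⟩
    exact key _ ((hp i).trans_lt (hn i))) hc hx
  simp only [Set.mem_setOf_eq, inner_sub_left, real_inner_self_eq_norm_sq] at hm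
  have h3 := norm_sub_sq_real p x
  have h4 := sq_nonneg ‖p - x‖
  linarith
end

section
/- Let V be a nonempty finite set of points in the Euclidean space ℝ^d, and let p and q be points in the convex hull of V. Then there exists v ∈ V such that dist(v, p) ≤ dist(v, q). -/
/-- For points `p, q` in the convex hull of a nonempty finite set `V`,
some vertex `v ∈ V` satisfies `dist v p ≤ dist v q`. -/
theorem exists_vertex_closer {d : ℕ}
    (V : Finset (EuclideanSpace ℝ (Fin d))) (hV : V.Nonempty)
    (p q : EuclideanSpace ℝ (Fin d))
    (hp : p ∈ convexHull ℝ (V : Set (EuclideanSpace ℝ (Fin d))))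
    (hq : q ∈ convexHull ℝ (V : Set (EuclideanSpace ℝ (Fin d)))) :
    ∃ v ∈ V, dist v p ≤ dist v q := by
  by_contra! h
  have key : ∀ x : EuclideanSpace ℝ (Fin d), dist x q < dist x p ↔
      innerSL ℝ (p - q) x < (‖p‖ ^ 2 - ‖q‖ ^ 2) / 2 := by
    intro x
    rw [← sq_lt_sq₀ dist_nonneg dist_nonneg, dist_eq_norm, dist_eq_norm,
      norm_sub_sq_real, norm_sub_sq_real, innerSL_apply_apply, inner_sub_left,
      real_inner_comm x p, real_inner_comm x q]
    constructor <;> intro h <;> linarith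
  have hc : Convex ℝ {x | innerSL ℝ (p - q) x < (‖p‖ ^ 2 - ‖q‖ ^ 2) / 2} :=
    convex_halfSpace_lt (innerSL ℝ (p - q)).toLinearMap.isLinear _
  have hm := convexHull_min (fun v hv => (key v).1 (h v hv)) hc hp
  have := (key p).2 hm
  rw [dist_self] at this
  exact absurd this (not_lt.2 dist_nonneg)
end

section
/- Let X be a finite set of points in the Euclidean space ℝ^d and let A ⊆ X be nonempty. Define the convex hull estimate conv̂(A) = {x ∈ X : for every q ∈ X there exists a ∈ A with dist(a, x) ≤ dist(a, q)}. Then every point of X that lies in the convex hull of A belongs to conv̂(A), i.e., conv(A) ∩ X ⊆ conv̂(A). (In fact, for every p ∈ conv(A) and every point q ∈ ℝ^d there exists a ∈ A with dist(a, p) ≤ dist(a, q).) -/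
/-- The convex hull estimate `conv̂(A)` contains `conv(A) ∩ X`; in fact for every
`p ∈ conv(A)` and every point `q`, some `a ∈ A` has `dist a p ≤ dist a q`. -/
theorem convexHull_inter_subset_estimate {d : ℕ}
    (X A : Finset (EuclideanSpace ℝ (Fin d))) (hAX : A ⊆ X) (hA : A.Nonempty) :
    (∀ x ∈ X, x ∈ convexHull ℝ (A : Set (EuclideanSpace ℝ (Fin d))) →
      ∀ q ∈ X, ∃ a ∈ A, dist a x ≤ dist a q) ∧
    (∀ p ∈ convexHull ℝ (A : Set (EuclideanSpace ℝ (Fin d))),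
      ∀ q : EuclideanSpace ℝ (Fin d), ∃ a ∈ A, dist a p ≤ dist a q) := by
  have key : ∀ p ∈ convexHull ℝ (A : Set (EuclideanSpace ℝ (Fin d))),
      ∀ q : EuclideanSpace ℝ (Fin d), ∃ a ∈ A, dist a p ≤ dist a q := by
    intro p hp q
    by_contra! h
    have hconv : Convex ℝ {a : EuclideanSpace ℝ (Fin d) |
        (‖q‖ ^ 2 - ‖p‖ ^ 2) / 2 < inner ℝ (q - p) a} :=
      convex_halfSpace_gt (f := fun a => inner ℝ (q - p) a)
        ⟨fun x y => inner_add_right _ _ _, fun c x => by simp [inner_smul_right]⟩ _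
    have hsub : (A : Set (EuclideanSpace ℝ (Fin d))) ⊆ {a : EuclideanSpace ℝ (Fin d) |
        (‖q‖ ^ 2 - ‖p‖ ^ 2) / 2 < inner ℝ (q - p) a} := by
      intro a ha
      have h1 := h a ha
      rw [dist_eq_norm, dist_eq_norm] at h1
      have h2 : ‖a - q‖ ^ 2 < ‖a - p‖ ^ 2 := by gcongr
      rw [norm_sub_sq_real, norm_sub_sq_real] at h2
      rw [Set.mem_setOf_eq]
      rw [inner_sub_left, real_inner_comm a q, real_inner_comm a p]
      linarith
    have h3 : (‖q‖ ^ 2 - ‖p‖ ^ 2) / 2 < inner ℝ (q - p) p := convexHull_min hsub hconv hp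
    rw [inner_sub_left, real_inner_self_eq_norm_sq] at h3
    have h4 := norm_sub_sq_real q p
    have h5 := sq_nonneg ‖q - p‖
    linarith
  exact ⟨fun x _ hx q _ => key x hx q, key⟩
end

section
/- Let P be a nonempty finite set of points in the Euclidean space ℝ^d and let p, q be points such that dist(a, p) > dist(a, q) for every a ∈ P (i.e., p is 'above' q with respect to P). Then p does not lie in the convex hull of P. -/
/-- If `p` is "above" `q` with respect to a nonempty finite set `P`
(farther from every member of `P`), then `p` is not in the convex hull of `P`. -/
theorem above_not_mem_convexHull {d : ℕ}
    (P : Finset (EuclideanSpace ℝ (Fin d))) (hP : P.Nonempty)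
    (p q : EuclideanSpace ℝ (Fin d))
    (habove : ∀ a ∈ P, dist a q < dist a p) :
    p ∉ convexHull ℝ (P : Set (EuclideanSpace ℝ (Fin d))) := by
  intro hp
  have hc : Convex ℝ {a : EuclideanSpace ℝ (Fin d) |
      (innerSL ℝ (p - q)) a < (‖p‖ ^ 2 - ‖q‖ ^ 2) / 2} :=
    convex_halfSpace_lt (innerSL ℝ (p - q)).toLinearMap.isLinear _
  have hm := convexHull_min (fun a ha => ?_) hc hp
  · have h0 := sq_nonneg ‖p - q‖
    rw [norm_sub_sq_real] at h0
    simp only [Set.mem_setOf_eq, innerSL_apply_apply, inner_sub_left,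
      real_inner_self_eq_norm_sq] at hm
    rw [real_inner_comm] at hm
    linarith
  · have h := habove a ha
    rw [dist_eq_norm, dist_eq_norm] at h
    have h2 := pow_lt_pow_left₀ h (norm_nonneg _) two_ne_zero
    rw [norm_sub_sq_real, norm_sub_sq_real] at h2
    simp only [Set.mem_setOf_eq, innerSL_apply_apply, inner_sub_left]
    rw [real_inner_comm a p, real_inner_comm a q]
    linarith
end

section
/- Let X be a finite set of points in the Euclidean space ℝ^d, let A ⊆ X be nonempty, and let conv̂(A) = {x ∈ X : for every q ∈ X there exists a ∈ A with dist(a, x) ≤ dist(a, q)}. Let m be the maximum distance between any two points of A, and let ε > 0 be such that every closed ball of radius ε centered at a point of the convex hull of A contains a member of X. Then: (1) for every c ∈ conv̂(A), the distance from c to the convex hull of A is at most √(ε(2m + ε)); and (2) for every c ∈ conv̂(A) there is no point x ∈ X such that dist(a, x) < dist(a, c) for all a ∈ A. -/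
/-- False positives of the convex hull estimate are close to `conv(A)`:
every `c ∈ conv̂(A)` is within distance `√(ε(2m+ε))` of `conv(A)`, and no `x ∈ X`
is strictly closer than `c` to all members of `A`. -/
theorem estimate_errors_near_hull {d : ℕ}
    (X A : Finset (EuclideanSpace ℝ (Fin d))) (hAX : A ⊆ X) (hA : A.Nonempty)
    (m ε : ℝ)
    (hm : m = Metric.diam (A : Set (EuclideanSpace ℝ (Fin d))))
    (hε : 0 < ε)
    (hdense : ∀ y ∈ convexHull ℝ (A : Set (EuclideanSpace ℝ (Fin d))),
      ∃ x ∈ X, dist x y ≤ ε)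
    (Chat : Set (EuclideanSpace ℝ (Fin d)))
    (hChat : Chat = {x | x ∈ X ∧ ∀ q ∈ X, ∃ a ∈ A, dist a x ≤ dist a q}) :
    (∀ c ∈ Chat,
      Metric.infDist c (convexHull ℝ (A : Set (EuclideanSpace ℝ (Fin d))))
        ≤ Real.sqrt (ε * (2 * m + ε))) ∧
    (∀ c ∈ Chat, ¬ ∃ x ∈ X, ∀ a ∈ A, dist a x < dist a c) := by
  subst hChat
  constructor
  · rintro c ⟨hcX, hc⟩
    have hcomp : IsCompact (convexHull ℝ (A : Set (EuclideanSpace ℝ (Fin d)))) :=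
      A.finite_toSet.isCompact_convexHull ℝ
    have hconv : Convex ℝ (convexHull ℝ (A : Set (EuclideanSpace ℝ (Fin d)))) :=
      convex_convexHull ℝ _
    have hne : (convexHull ℝ (A : Set (EuclideanSpace ℝ (Fin d)))).Nonempty := by
      obtain ⟨a, ha⟩ := hA
      exact ⟨a, subset_convexHull ℝ _ ha⟩
    obtain ⟨p, hp, hpe⟩ := exists_norm_eq_iInf_of_complete_convex hne hcomp.isComplete hconv c
    have hin := (norm_eq_iInf_iff_real_inner_le_zero hconv hp).1 hpe
    obtain ⟨x, hx, hxp⟩ := hdense p hp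
    obtain ⟨a, ha, hac⟩ := hc x hx
    have haH : a ∈ convexHull ℝ (A : Set (EuclideanSpace ℝ (Fin d))) :=
      subset_convexHull ℝ _ ha
    have h1 : dist a p ≤ m := by
      rw [hm, ← convexHull_diam]
      exact Metric.dist_le_diam_of_mem hcomp.isBounded haH hp
    have h2 : dist a c ≤ dist a p + ε := by
      have := dist_triangle a p x
      rw [dist_comm p x] at this
      linarith
    have h3 : dist a p ^ 2 + dist c p ^ 2 ≤ dist a c ^ 2 := by
      have h4 := hin a haH
      have h5 := norm_sub_sq_real (c - p) (a - p)
      have h6 : c - p - (a - p) = c - a := by abel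
      rw [h6] at h5
      rw [dist_comm a c, dist_eq_norm, dist_eq_norm, dist_eq_norm, h5]
      linarith
    refine (Metric.infDist_le_dist_of_mem hp).trans (Real.le_sqrt_of_sq_le ?_)
    have h7 : dist a c ^ 2 ≤ (dist a p + ε) ^ 2 := by gcongr
    nlinarith [mul_le_mul_of_nonneg_left h1 hε.le]
  · rintro c ⟨hcX, hc⟩ ⟨x, hx, h⟩
    obtain ⟨a, ha, hac⟩ := hc x hx
    exact absurd (h a ha) (not_lt.2 hac)
end

section
/- Let p, q, v be points in the Euclidean space ℝ^d such that the inner product ⟨v − q, p − q⟩ ≤ 0, and let ε ≥ 0 satisfy dist(p, q)² ≥ ε² + 2ε·dist(v, q). Then dist(v, q) + ε ≤ dist(v, p); consequently the closed ball of radius ε centered at q is contained in the closed ball centered at v of radius dist(v, p). -/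
open scoped RealInnerProductSpace

/-- If the angle at `q` between `v` and `p` is at least 90° and
`dist(p,q)² ≥ ε² + 2ε·dist(v,q)`, then `dist(v,q) + ε ≤ dist(v,p)`, so the
`ε`-ball at `q` lies in the ball centered at `v` of radius `dist(v,p)`. -/
theorem eps_ball_subset_of_height {d : ℕ}
    (p q v : EuclideanSpace ℝ (Fin d)) (ε : ℝ) (hε : 0 ≤ ε)
    (hangle : ⟪v - q, p - q⟫ ≤ 0)
    (hheight : ε ^ 2 + 2 * ε * dist v q ≤ dist p q ^ 2) :
    dist v q + ε ≤ dist v p ∧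
    Metric.closedBall q ε ⊆ Metric.closedBall v (dist v p) := by
  have key : dist v q + ε ≤ dist v p := by
    have h := norm_sub_sq_real (v - q) (p - q)
    rw [sub_sub_sub_cancel_right, ← dist_eq_norm, ← dist_eq_norm, ← dist_eq_norm] at h
    refine abs_le_of_sq_le_sq' ?_ dist_nonneg |>.2
    nlinarith
  refine ⟨key, Metric.closedBall_subset_closedBall' ?_⟩
  rw [dist_comm q v]
  linarith
end

section
/- Let V = {v₀, …, v_k} be an affinely independent finite set of points in the Euclidean space ℝ^d, and let p be a point in the convex hull of V. Then the convex hull of V equals the union over v ∈ V of the convex hulls of (V \ {v}) ∪ {p}; that is, conv(V) = ⋃_{v ∈ V} conv((V \ {v}) ∪ {p}). -/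
/-- Partitioning a simplex by an interior point: for affinely independent `V` and
`p ∈ conv(V)`, `conv(V)` is the union over `v ∈ V` of `conv((V \ {v}) ∪ {p})`. -/
theorem simplex_partition_by_point {d : ℕ}
    (V : Finset (EuclideanSpace ℝ (Fin d)))
    (hV : AffineIndependent ℝ (Subtype.val : ↥(V : Set (EuclideanSpace ℝ (Fin d))) → EuclideanSpace ℝ (Fin d)))
    (p : EuclideanSpace ℝ (Fin d))
    (hp : p ∈ convexHull ℝ (V : Set (EuclideanSpace ℝ (Fin d)))) :
    convexHull ℝ (V : Set (EuclideanSpace ℝ (Fin d))) =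
      ⋃ v ∈ V, convexHull ℝ (((V : Set (EuclideanSpace ℝ (Fin d))) \ {v}) ∪ {p}) := by
  classical
  apply Set.Subset.antisymm
  · intro x hx
    rw [Finset.mem_convexHull'] at hp hx
    obtain ⟨w, hw0, hw1, hwp⟩ := hp
    obtain ⟨u, hu0, hu1, hux⟩ := hx
    have hne : (V.filter (fun y => 0 < w y)).Nonempty := by
      by_contra h
      rw [Finset.not_nonempty_iff_eq_empty, Finset.filter_eq_empty_iff] at h
      have : ∑ y ∈ V, w y ≤ 0 := Finset.sum_nonpos (fun y hy => not_lt.mp (h hy))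
      linarith
    obtain ⟨v, hv, hmin⟩ := Finset.exists_min_image _ (fun y => u y / w y) hne
    rw [Finset.mem_filter] at hv
    obtain ⟨hvV, hwv⟩ := hv
    obtain ⟨t, ht⟩ : ∃ t, t = u v / w v := ⟨_, rfl⟩
    have ht0 : 0 ≤ t := ht ▸ div_nonneg (hu0 v hvV) hwv.le
    have htv : u v - t * w v = 0 := by rw [ht]; field_simp; ring
    have hc : ∀ y ∈ V, 0 ≤ u y - t * w y := by
      intro y hy
      rcases (hw0 y hy).lt_or_eq with h | h
      · have := hmin y (Finset.mem_filter.mpr ⟨hy, h⟩)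
        simp only [← ht] at this
        rw [le_div_iff₀ h] at this
        linarith
      · rw [← h]; simpa using hu0 y hy
    refine Set.mem_iUnion₂.mpr ⟨v, hvV, ?_⟩
    have key := (convex_convexHull ℝ (((V : Set (EuclideanSpace ℝ (Fin d))) \ {v}) ∪ {p})).sum_mem
      (t := V) (w := fun y => (u y - t * w y) + if y = v then t else 0)
      (z := fun y => if y = v then p else y) ?_ ?_ ?_
    · convert key using 1
      have : ∀ y ∈ V, ((u y - t * w y) + if y = v then t else 0) • (if y = v then p else y)
          = (u y • y - t • (w y • y)) + if y = v then t • p else 0 := by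
        intro y _
        by_cases h : y = v
        · subst h
          have h2 : u y = t * w y := by linarith
          simp [h2, mul_smul]
        · simp [h, sub_smul, mul_smul]
      rw [Finset.sum_congr rfl this, Finset.sum_add_distrib, Finset.sum_sub_distrib,
        ← Finset.smul_sum, hwp, hux, Finset.sum_ite_eq' V v, if_pos hvV]
      simp
    · intro y hy
      have := hc y hy
      split_ifs <;> linarith
    · rw [Finset.sum_add_distrib, Finset.sum_sub_distrib, ← Finset.mul_sum, hw1, hu1,
        Finset.sum_ite_eq' V v, if_pos hvV]
      ring
    · intro y hy
      apply subset_convexHull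
      by_cases h : y = v
      · simp [h]
      · left
        simpa [h] using hy
  · refine Set.iUnion₂_subset fun v _ => convexHull_min ?_ (convex_convexHull ℝ _)
    rintro y (hy | hy)
    · exact subset_convexHull ℝ _ hy.1
    · rw [Set.mem_singleton_iff.mp hy]; exact hp
end
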